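/- Let M be a rational cohomology algebra carrying a Hodge structure, and suppose M is isomorphic, as a graded ℚ-algebra, to the graded tensor product A ⊗ B of two rational cohomology algebras A and B such that A¹ = 0 and both A and B are generated as algebras by their components of degree at most 2. Then dim A and dim B are even, and there exist Hodge structures on A and B whose tensor product Hodge structure on A ⊗ B corresponds, under the given isomorphism, to the given Hodge structure on M. -/

import Mathlib

open TensorProduct

noncomputable def conjQ (V : Type) [AddCommGroup V] [Module ℚ V] :
    ℂ ⊗[ℚ] V →ₗ[ℚ] ℂ ⊗[ℚ] V :=
  LinearMap.rTensor V ((starAddEquiv : ℂ ≃+ ℂ).toAddMonoidHom.toRatLinearMap)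

structure IsCohomologyAlgebra (F : Type) [Field F] (A : Type) [Ring A] [Algebra F A]
    (𝒜 : ℕ → Submodule F A) [GradedAlgebra 𝒜] (m : ℕ) : Prop where
  finite : FiniteDimensional F A
  gcomm : ∀ (k l : ℕ) (x y : A), x ∈ 𝒜 k → y ∈ 𝒜 l →
    x * y = ((-1 : F) ^ (k * l)) • (y * x)
  degZero : 𝒜 0 ≤ Submodule.span F {(1 : A)}
  vanish : ∀ k, m < k → 𝒜 k = ⊥
  topRank : Module.finrank F ↥(𝒜 m) = 1
  nondeg : ∀ k, k ≤ m → ∀ x ∈ 𝒜 k, x ≠ 0 → ∃ y ∈ 𝒜 (m - k), x * y ≠ 0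

structure AlgHodgeStructureQ (A : Type) [Ring A] [Algebra ℚ A]
    (𝒜 : ℕ → Submodule ℚ A) where
  H : ℕ → ℤ → Submodule ℂ (ℂ ⊗[ℚ] A)
  indep : ∀ k : ℕ, iSupIndep (H k)
  supEq : ∀ k : ℕ, (⨆ p : ℤ, H k p) = (𝒜 k).baseChange ℂ
  conj_mem : ∀ (k : ℕ) (p : ℤ), ∀ x ∈ H k p, conjQ A x ∈ H k (k - p)
  mul_mem : ∀ (k l : ℕ) (p p' : ℤ), ∀ x ∈ H k p, ∀ y ∈ H l p',
    x * y ∈ H (k + l) (p + p')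

section TensorIso

variable (A B M : Type) [Ring A] [Algebra ℚ A] [Ring B] [Algebra ℚ B]
  [Ring M] [Algebra ℚ M]

/-- `φ : A ⊗ B ≃ M` is an isomorphism of graded algebras, where `A ⊗ B` carries the
graded (Koszul sign) tensor product algebra structure. -/
structure IsGradedTensorIso (𝒜 : ℕ → Submodule ℚ A) (ℬ : ℕ → Submodule ℚ B)
    (𝕄 : ℕ → Submodule ℚ M) (φ : (A ⊗[ℚ] B) ≃ₗ[ℚ] M) : Prop where
  map_one : φ ((1 : A) ⊗ₜ[ℚ] (1 : B)) = 1
  map_grade : ∀ (i j : ℕ), ∀ a ∈ 𝒜 i, ∀ b ∈ ℬ j, φ (a ⊗ₜ[ℚ] b) ∈ 𝕄 (i + j)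
  grade_eq : ∀ k : ℕ, 𝕄 k = ⨆ (i : ℕ) (j : ℕ) (_ : i + j = k),
    Submodule.map φ.toLinearMap (Submodule.map₂ (TensorProduct.mk ℚ A B) (𝒜 i) (ℬ j))
  map_mul : ∀ (i j i' j' : ℕ), ∀ a ∈ 𝒜 i, ∀ b ∈ ℬ j, ∀ a' ∈ 𝒜 i', ∀ b' ∈ ℬ j',
    φ (a ⊗ₜ[ℚ] b) * φ (a' ⊗ₜ[ℚ] b') =
      ((-1 : ℚ) ^ (j * i')) • φ ((a * a') ⊗ₜ[ℚ] (b * b'))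

/-- The embedding `A → M`, `a ↦ φ(a ⊗ 1)`. -/
noncomputable def inclA (φ : (A ⊗[ℚ] B) ≃ₗ[ℚ] M) : A →ₗ[ℚ] M :=
  φ.toLinearMap ∘ₗ ((TensorProduct.mk ℚ A B).flip 1)

/-- The embedding `B → M`, `b ↦ φ(1 ⊗ b)`. -/
noncomputable def inclB (φ : (A ⊗[ℚ] B) ≃ₗ[ℚ] M) : B →ₗ[ℚ] M :=
  φ.toLinearMap ∘ₗ (TensorProduct.mk ℚ A B 1)

end TensorIso

section Complexification

variable {V W : Type} [AddCommGroup V] [Module ℚ V] [AddCommGroup W] [Module ℚ W]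

theorem conjQ_baseChange (f : V →ₗ[ℚ] W) (x : ℂ ⊗[ℚ] V) :
    conjQ W (f.baseChange ℂ x) = f.baseChange ℂ (conjQ V x) := by
  induction x with
  | zero => simp
  | tmul c v => simp [conjQ]
  | add x y hx hy => simp only [map_add, hx, hy]

theorem conjQ_one_tmul (v : V) : conjQ V ((1 : ℂ) ⊗ₜ[ℚ] v) = 1 ⊗ₜ[ℚ] v := by
  simp [conjQ]

theorem baseChange_injective {f : V →ₗ[ℚ] W} (hf : Function.Injective f) :
    Function.Injective (f.baseChange ℂ) :=
  Module.Flat.lTensor_preserves_injective_linearMap f hf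

/-- A complex subspace contains the complexification of `p` once it contains `p`. -/
theorem Submodule.baseChange_le {p : Submodule ℚ V} {S : Submodule ℂ (ℂ ⊗[ℚ] V)}
    (h : ∀ v ∈ p, (1 : ℂ) ⊗ₜ[ℚ] v ∈ S) : p.baseChange ℂ ≤ S := by
  rw [Submodule.baseChange_eq_span, Submodule.span_le]
  rintro _ ⟨v, hv, rfl⟩
  exact h v hv

theorem Submodule.map_baseChange (f : V →ₗ[ℚ] W) (p : Submodule ℚ V) :
    (p.map f).baseChange ℂ = (p.baseChange ℂ).map (f.baseChange ℂ) := by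
  apply le_antisymm
  · apply Submodule.baseChange_le
    rintro _ ⟨v, hv, rfl⟩
    exact ⟨1 ⊗ₜ v, Submodule.tmul_mem_baseChange_of_mem 1 hv, by simp⟩
  · rw [Submodule.map_le_iff_le_comap]
    apply Submodule.baseChange_le
    intro v hv
    simpa using Submodule.tmul_mem_baseChange_of_mem (1 : ℂ) (Submodule.mem_map_of_mem hv)

theorem Submodule.baseChange_sup_le (p q : Submodule ℚ V) :
    (p ⊔ q).baseChange ℂ ≤ p.baseChange ℂ ⊔ q.baseChange ℂ := by
  apply Submodule.baseChange_le
  intro v hv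
  obtain ⟨x, hx, y, hy, rfl⟩ := Submodule.mem_sup.1 hv
  rw [TensorProduct.tmul_add]
  exact add_mem (Submodule.mem_sup_left (Submodule.tmul_mem_baseChange_of_mem 1 hx))
    (Submodule.mem_sup_right (Submodule.tmul_mem_baseChange_of_mem 1 hy))

theorem iSup_baseChange_eq_top {ι : Type*} {p : ι → Submodule ℚ V} (h : ⨆ i, p i = ⊤) :
    ⨆ i, (p i).baseChange ℂ = ⊤ := by
  rw [eq_top_iff, ← Submodule.baseChange_top, ← h]
  apply Submodule.baseChange_le
  intro v hv
  refine Submodule.iSup_induction p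
    (motive := fun v => (1 : ℂ) ⊗ₜ[ℚ] v ∈ ⨆ i, (p i).baseChange ℂ) hv ?_ ?_ ?_
  · exact fun i x hx =>
      Submodule.mem_iSup_of_mem i (Submodule.tmul_mem_baseChange_of_mem 1 hx)
  · simp
  · intro x y hx hy
    rw [TensorProduct.tmul_add]
    exact add_mem hx hy

end Complexification

section GradedComplexification

variable {M : Type} [Ring M] [Algebra ℚ M]

theorem baseChange_map_mul {C : Type} [Ring C] [Algebra ℚ C] {f : C →ₗ[ℚ] M}
    (hf : ∀ x y, f (x * y) = f x * f y) (x y : ℂ ⊗[ℚ] C) :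
    f.baseChange ℂ (x * y) = f.baseChange ℂ x * f.baseChange ℂ y := by
  induction x with
  | zero => simp
  | add x x' hx hx' => simp only [add_mul, map_add, hx, hx']
  | tmul c v =>
    induction y with
    | zero => simp
    | add y y' hy hy' => simp only [mul_add, map_add, hy, hy']
    | tmul d w => simp [hf]

variable (𝕄 : ℕ → Submodule ℚ M) [GradedAlgebra 𝕄]

theorem iSup_grade_baseChange : ⨆ k, (𝕄 k).baseChange ℂ = ⊤ :=
  iSup_baseChange_eq_top (DirectSum.Decomposition.isInternal 𝕄).submodule_iSup_eq_top

theorem iSupIndep_grade_baseChange : iSupIndep fun k => (𝕄 k).baseChange ℂ := by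
  intro k
  rw [Submodule.disjoint_def]
  intro x hx hx'
  have hid : (𝕄 k).baseChange ℂ ≤
      LinearMap.eqLocus ((GradedAlgebra.proj 𝕄 k).baseChange ℂ) LinearMap.id := by
    apply Submodule.baseChange_le
    intro v hv
    simp [GradedAlgebra.proj_apply, DirectSum.decompose_of_mem_same 𝕄 hv]
  have hzero : (⨆ (l) (_ : l ≠ k), (𝕄 l).baseChange ℂ) ≤
      LinearMap.ker ((GradedAlgebra.proj 𝕄 k).baseChange ℂ) := by
    refine iSup₂_le fun l hl => Submodule.baseChange_le fun v hv => ?_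
    simp [GradedAlgebra.proj_apply, DirectSum.decompose_of_mem_ne 𝕄 hv hl]
  exact (hid hx).symm.trans (hzero hx')

end GradedComplexification

namespace AlgHodgeStructureQ

variable {M : Type} [Ring M] [Algebra ℚ M] {𝕄 : ℕ → Submodule ℚ M}
  (HS : AlgHodgeStructureQ M 𝕄)

theorem H_le (k : ℕ) (p : ℤ) : HS.H k p ≤ (𝕄 k).baseChange ℂ :=
  (le_iSup (HS.H k) p).trans (HS.supEq k).le

/-- The eigenvalue on `H i.1 i.2` of the derivation attached to a Hodge structure. -/
noncomputable def weight (i : ℕ × ℤ) : ℂ := i.1 + i.2 * Complex.I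

theorem weight_injective : Function.Injective weight := by
  rintro ⟨k, p⟩ ⟨l, q⟩ h
  have hre := congrArg Complex.re h
  have him := congrArg Complex.im h
  simp [weight] at hre him
  rw [hre, him]

/-- The top degree of an algebra with a Hodge structure is even. -/
theorem even_of_finrank_eq_one (HS : AlgHodgeStructureQ M 𝕄) {d : ℕ} (hd : Module.finrank ℚ (𝕄 d) = 1) : Even d := by
  obtain ⟨e, he, hspan⟩ := finrank_eq_one_iff'.1 hd
  have hne : (1 : ℂ) ⊗ₜ[ℚ] (e : M) ≠ 0 := by
    intro h
    have hi : Function.Injective (TensorProduct.mk ℚ ℂ M 1) :=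
      Module.FaithfullyFlat.tensorProduct_mk_injective (A := ℚ) (B := ℂ) M
    exact he (Subtype.ext (hi (by simpa using h)))
  have hle : (𝕄 d).baseChange ℂ ≤ Submodule.span ℂ {(1 : ℂ) ⊗ₜ[ℚ] (e : M)} := by
    apply Submodule.baseChange_le
    intro v hv
    obtain ⟨c, hc⟩ := hspan ⟨v, hv⟩
    have hv' : v = c • (e : M) := congrArg Subtype.val hc.symm
    rw [hv', TensorProduct.tmul_smul, ← algebraMap_smul ℂ]
    exact Submodule.smul_mem _ _ (Submodule.mem_span_singleton_self _)
  have hex : ∃ p, HS.H d p ≠ ⊥ := by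
    by_contra! h
    have hbot := HS.supEq d
    simp only [h, iSup_bot] at hbot
    have : (1 : ℂ) ⊗ₜ[ℚ] (e : M) ∈ (𝕄 d).baseChange ℂ :=
      Submodule.tmul_mem_baseChange_of_mem 1 e.2
    rw [← hbot] at this
    exact hne (by simpa using this)
  obtain ⟨p, hp⟩ := hex
  obtain ⟨x, hx, hx0⟩ := (Submodule.ne_bot_iff _).1 hp
  obtain ⟨c, rfl⟩ := Submodule.mem_span_singleton.1 (hle (HS.H_le d p hx))
  have hc : c ≠ 0 := fun h => hx0 (by rw [h, zero_smul])
  have hep : (1 : ℂ) ⊗ₜ[ℚ] (e : M) ∈ HS.H d p := (Submodule.smul_mem_iff _ hc).1 hx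
  have hep' := HS.conj_mem d p _ hep
  rw [conjQ_one_tmul] at hep'
  by_contra hodd
  have hpp : p ≠ d - p := by
    intro h
    exact hodd ((Int.even_coe_nat d).1 ⟨p, by omega⟩)
  exact hne (Submodule.disjoint_def.1 ((HS.indep d).pairwiseDisjoint hpp) _ hep hep')

variable {HS} in
theorem derivation_mem_grade {D : Module.End ℂ (ℂ ⊗[ℚ] M)}
    (hD : ∀ (i : ℕ × ℤ), ∀ x ∈ HS.H i.1 i.2, D x = weight i • x) {k : ℕ}
    {x : ℂ ⊗[ℚ] M} (hx : x ∈ (𝕄 k).baseChange ℂ) : D x ∈ (𝕄 k).baseChange ℂ := by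
  rw [← HS.supEq k] at hx ⊢
  induction hx using Submodule.iSup_induction' with
  | zero => simp
  | add x y _ _ h h' => rw [map_add]; exact add_mem h h'
  | mem p x hx =>
    rw [hD (k, p) x hx]
    exact Submodule.smul_mem _ _ (Submodule.mem_iSup_of_mem p hx)

variable [GradedAlgebra 𝕄]

theorem iSup_H : ⨆ i : ℕ × ℤ, HS.H i.1 i.2 = ⊤ := by
  rw [iSup_prod, ← iSup_grade_baseChange 𝕄]
  exact iSup_congr HS.supEq

theorem iSupIndep_H : iSupIndep fun i : ℕ × ℤ => HS.H i.1 i.2 := by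
  rintro ⟨k, p⟩
  rw [Submodule.disjoint_def]
  intro x hx hx'
  have hle : (⨆ (j : ℕ × ℤ) (_ : j ≠ (k, p)), HS.H j.1 j.2) ≤
      (⨆ (q) (_ : q ≠ p), HS.H k q) ⊔ ⨆ (l) (_ : l ≠ k), (𝕄 l).baseChange ℂ := by
    refine iSup₂_le ?_
    rintro ⟨l, q⟩ hlq
    by_cases hl : l = k
    · subst hl
      have hq : q ≠ p := fun h => hlq (by rw [h])
      exact le_sup_of_le_left (le_iSup₂ (f := fun q (_ : q ≠ p) => HS.H l q) q hq)
    · exact le_sup_of_le_right ((HS.H_le l q).trans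
        (le_iSup₂ (f := fun l (_ : l ≠ k) => (𝕄 l).baseChange ℂ) l hl))
  obtain ⟨y, hy, z, hz, rfl⟩ := Submodule.mem_sup.1 (hle hx')
  have hyk : y ∈ (𝕄 k).baseChange ℂ :=
    (iSup₂_le fun q _ => HS.H_le k q : (⨆ (q) (_ : q ≠ p), HS.H k q) ≤ _) hy
  have hzk : z ∈ (𝕄 k).baseChange ℂ := by
    simpa using sub_mem (HS.H_le k p hx) hyk
  have hz0 : z = 0 :=
    Submodule.disjoint_def.1 (iSupIndep_grade_baseChange 𝕄 k) z hzk hz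
  subst hz0
  rw [add_zero] at hx ⊢
  exact Submodule.disjoint_def.1 (HS.indep k p) y hx hy

theorem exists_derivation : ∃ D : Module.End ℂ (ℂ ⊗[ℚ] M),
    (∀ (i : ℕ × ℤ), ∀ x ∈ HS.H i.1 i.2, D x = weight i • x) ∧
    ∀ x y, D (x * y) = D x * y + x * D y := by
  classical
  let e := LinearEquiv.ofBijective
    (DirectSum.coeLinearMap fun i : ℕ × ℤ => HS.H i.1 i.2)
    (DirectSum.isInternal_submodule_of_iSupIndep_of_iSup_eq_top HS.iSupIndep_H HS.iSup_H)
  let D : Module.End ℂ (ℂ ⊗[ℚ] M) :=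
    (DirectSum.toModule ℂ (ℕ × ℤ) _ fun i => weight i • (HS.H i.1 i.2).subtype) ∘ₗ
      e.symm.toLinearMap
  have hD : ∀ (i : ℕ × ℤ), ∀ x ∈ HS.H i.1 i.2, D x = weight i • x := by
    intro i x hx
    have he : e (DirectSum.lof ℂ _ (fun i : ℕ × ℤ => HS.H i.1 i.2) i ⟨x, hx⟩) = x := by
      exact DirectSum.coeLinearMap_lof _ i ⟨x, hx⟩
    have he' : e.symm x = DirectSum.lof ℂ _ (fun i : ℕ × ℤ => HS.H i.1 i.2) i ⟨x, hx⟩ := by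
      rw [LinearEquiv.symm_apply_eq, he]
    simp [D, he']
  refine ⟨D, hD, fun x y => ?_⟩
  have hx : x ∈ ⨆ i : ℕ × ℤ, HS.H i.1 i.2 := by rw [HS.iSup_H]; trivial
  have hy : y ∈ ⨆ i : ℕ × ℤ, HS.H i.1 i.2 := by rw [HS.iSup_H]; trivial
  induction hx using Submodule.iSup_induction' with
  | zero => simp
  | add x x' _ _ h h' => simp only [add_mul, map_add, h, h']; abel
  | mem i x hx =>
    induction hy using Submodule.iSup_induction' with
    | zero => simp
    | add y y' _ _ h h' => simp only [mul_add, map_add, h, h']; abel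
    | mem j y hy =>
      rw [hD i x hx, hD j y hy, hD (i + j) _ (HS.mul_mem _ _ _ _ x hx y hy),
        smul_mul_assoc, mul_smul_comm, ← add_smul]
      congr 1
      simp [weight]
      ring

variable {HS} in
/-- A subspace stable under the derivation is the sum of its Hodge components. -/
theorem le_iSup_inf_H [FiniteDimensional ℚ M] {D : Module.End ℂ (ℂ ⊗[ℚ] M)}
    (hD : ∀ (i : ℕ × ℤ), ∀ x ∈ HS.H i.1 i.2, D x = weight i • x)
    {S : Submodule ℂ (ℂ ⊗[ℚ] M)} (hS : ∀ x ∈ S, D x ∈ S) :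
    S ≤ ⨆ i : ℕ × ℤ, S ⊓ HS.H i.1 i.2 := by
  let R : ℂ → Submodule ℂ (ℂ ⊗[ℚ] M) := fun μ =>
    ⨆ (i : ℕ × ℤ) (_ : weight i = μ), HS.H i.1 i.2
  have hR : R ≤ D.eigenspace := by
    intro μ
    refine iSup₂_le ?_
    rintro i rfl x hx
    exact Module.End.mem_eigenspace_iff.2 (hD i x hx)
  have htop : iSup R = ⊤ := by
    rw [eq_top_iff, ← HS.iSup_H]
    exact iSup_le fun i => le_iSup_of_le (weight i)
      (le_iSup₂ (f := fun j (_ : weight j = weight i) => HS.H j.1 j.2) i rfl)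
  have hEq : R = D.eigenspace :=
    ((Module.End.eigenspaces_iSupIndep D).le_iff_eq_of_iSup_eq_top htop).1 hR
  have h := Submodule.inf_iSup_genEigenspace hS 1
  change S ⊓ ⨆ μ, D.eigenspace μ = ⨆ μ, S ⊓ D.eigenspace μ at h
  rw [← hEq, htop, inf_top_eq] at h
  rw [h]
  refine iSup_le fun μ => ?_
  rw [← h]
  by_cases hμ : ∃ i, weight i = μ
  · obtain ⟨i, rfl⟩ := hμ
    refine le_iSup_of_le i (inf_le_inf_left S (iSup₂_le fun j hj => ?_))
    rw [weight_injective hj]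
  · push Not at hμ
    simp [R, hμ]

end AlgHodgeStructureQ

section Restriction

variable {M C : Type} [Ring M] [Algebra ℚ M] [Ring C] [Algebra ℚ C]
  {𝕄 : ℕ → Submodule ℚ M} {𝒞 : ℕ → Submodule ℚ C}

theorem iSupIndep.submodule_comap {ι K V W : Type*} [Ring K] [AddCommGroup V] [Module K V]
    [AddCommGroup W] [Module K W] {p : ι → Submodule K W} (hp : iSupIndep p)
    {f : V →ₗ[K] W} (hf : Function.Injective f) : iSupIndep fun i => (p i).comap f := by
  intro i
  rw [Submodule.disjoint_def]
  intro x hx hx'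
  have hle : (⨆ (j) (_ : j ≠ i), (p j).comap f) ≤ (⨆ (j) (_ : j ≠ i), p j).comap f :=
    iSup₂_le fun j hj => Submodule.comap_mono (le_iSup₂ (f := fun j (_ : j ≠ i) => p j) j hj)
  exact hf ((Submodule.disjoint_def.1 (hp i) _ hx (hle hx')).trans (map_zero f).symm)

theorem AlgHodgeStructureQ.iSup_comap_H (HS : AlgHodgeStructureQ M 𝕄)
    {f : C →ₗ[ℚ] M} (hinj : Function.Injective f)
    (hrange : LinearMap.range (f.baseChange ℂ) ≤
      ⨆ i : ℕ × ℤ, LinearMap.range (f.baseChange ℂ) ⊓ HS.H i.1 i.2) :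
    ⨆ i : ℕ × ℤ, (HS.H i.1 i.2).comap (f.baseChange ℂ) = ⊤ := by
  rw [eq_top_iff]
  intro x _
  have hx := hrange (LinearMap.mem_range_self _ x)
  simp_rw [← Submodule.map_comap_eq, ← Submodule.map_iSup] at hx
  obtain ⟨y, hy, hxy⟩ := hx
  exact baseChange_injective hinj hxy ▸ hy

variable [GradedAlgebra 𝕄] [GradedAlgebra 𝒞]

theorem baseChange_grade_eq_comap {f : C →ₗ[ℚ] M} (hinj : Function.Injective f)
    (hgr : ∀ k, ∀ x ∈ 𝒞 k, f x ∈ 𝕄 k) (k : ℕ) :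
    (𝒞 k).baseChange ℂ = ((𝕄 k).baseChange ℂ).comap (f.baseChange ℂ) := by
  have hind := (iSupIndep_grade_baseChange 𝕄).submodule_comap (baseChange_injective hinj)
  refine congrFun ((hind.le_iff_eq_of_iSup_eq_top (iSup_grade_baseChange 𝒞)).1 ?_) k
  refine fun l => Submodule.baseChange_le fun v hv => ?_
  simpa using Submodule.tmul_mem_baseChange_of_mem (1 : ℂ) (hgr l v hv)

namespace AlgHodgeStructureQ

variable (HS : AlgHodgeStructureQ M 𝕄)

/-- The Hodge structure induced on a graded subalgebra that is the sum of its Hodge components. -/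
noncomputable def comap (f : C →ₗ[ℚ] M) (hinj : Function.Injective f)
    (hmul : ∀ x y, f (x * y) = f x * f y) (hgr : ∀ k, ∀ x ∈ 𝒞 k, f x ∈ 𝕄 k)
    (hrange : LinearMap.range (f.baseChange ℂ) ≤
      ⨆ i : ℕ × ℤ, LinearMap.range (f.baseChange ℂ) ⊓ HS.H i.1 i.2) :
    AlgHodgeStructureQ C 𝒞 where
  H k p := (HS.H k p).comap (f.baseChange ℂ)
  indep k := (HS.indep k).submodule_comap (baseChange_injective hinj)
  supEq k := by
    have hind := (iSupIndep_grade_baseChange 𝕄).submodule_comap (baseChange_injective hinj)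
    have htop := HS.iSup_comap_H hinj hrange
    rw [iSup_prod] at htop
    rw [baseChange_grade_eq_comap hinj hgr]
    refine congrFun ((hind.le_iff_eq_of_iSup_eq_top htop).1 ?_) k
    exact fun l => iSup_le fun p => Submodule.comap_mono (HS.H_le l p)
  conj_mem k p x hx := by
    rw [Submodule.mem_comap, ← conjQ_baseChange]
    exact HS.conj_mem k p _ hx
  mul_mem k l p p' x hx y hy := by
    rw [Submodule.mem_comap, baseChange_map_mul hmul]
    exact HS.mul_mem k l p p' _ hx _ hy

end AlgHodgeStructureQ

theorem derivation_mem_range {f : C →ₗ[ℚ] M} (hone : f 1 = 1)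
    (hmul : ∀ x y, f (x * y) = f x * f y) {D : Module.End ℂ (ℂ ⊗[ℚ] M)}
    (hD : ∀ x y, D (x * y) = D x * y + x * D y) {s : Set C} (hs : Algebra.adjoin ℚ s = ⊤)
    (h : ∀ x ∈ s, D (1 ⊗ₜ f x) ∈ LinearMap.range (f.baseChange ℂ)) :
    ∀ y ∈ LinearMap.range (f.baseChange ℂ), D y ∈ LinearMap.range (f.baseChange ℂ) := by
  have hgen : ∀ x : C, D (1 ⊗ₜ f x) ∈ LinearMap.range (f.baseChange ℂ) := by
    intro x
    have hx : x ∈ Algebra.adjoin ℚ s := hs ▸ Algebra.mem_top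
    induction hx using Algebra.adjoin_induction with
    | mem x hx => exact h x hx
    | algebraMap r =>
      have h1 : D 1 = 0 := by simpa using hD 1 1
      rw [Algebra.algebraMap_eq_smul_one, map_smul, hone, TensorProduct.tmul_smul,
        ← algebraMap_smul ℂ, map_smul, ← Algebra.TensorProduct.one_def, h1, smul_zero]
      exact zero_mem _
    | add x y _ _ hx hy =>
      rw [map_add, TensorProduct.tmul_add, map_add]
      exact add_mem hx hy
    | mul x y _ _ hx hy =>
      obtain ⟨u, hu⟩ := hx
      obtain ⟨v, hv⟩ := hy
      have hxy : (1 : ℂ) ⊗ₜ[ℚ] f (x * y) = (1 ⊗ₜ f x) * (1 ⊗ₜ f y) := by simp [hmul]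
      rw [hxy, hD, ← hu, ← hv]
      refine ⟨u * (1 ⊗ₜ y) + (1 ⊗ₜ x) * v, ?_⟩
      simp [baseChange_map_mul hmul]
  rintro _ ⟨x, rfl⟩
  have hx : x ∈ (⊤ : Submodule ℚ C).baseChange ℂ := by simp
  have hle : (⊤ : Submodule ℚ C).baseChange ℂ ≤
      (LinearMap.range (f.baseChange ℂ)).comap (D ∘ₗ f.baseChange ℂ) :=
    Submodule.baseChange_le fun v _ => by simpa using hgen v
  exact hle hx

theorem derivation_pow_succ {R : Type*} [Ring R] {D : R → R}
    (hD : ∀ x y, D (x * y) = D x * y + x * D y) {x : R} (hx : ∀ y, Commute x y) (n : ℕ) :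
    D (x ^ (n + 1)) = (n + 1) * (x ^ n * D x) := by
  induction n with
  | zero => simp
  | succ n ih =>
    rw [pow_succ, hD, ih, mul_assoc, mul_assoc, ← (hx (D x)).eq, ← mul_assoc (x ^ n), ← pow_succ]
    push_cast
    noncomm_ring

end Restriction

section Polarization

theorem coeff_eq_zero_of_sum_pow_smul {V : Type*} [AddCommGroup V] [Module ℚ V] {n : ℕ}
    {c : ℕ → V} (h : ∀ t : ℚ, ∑ i ∈ Finset.range n, t ^ i • c i = 0) {i : ℕ} (hi : i < n) :
    c i = 0 := by
  rw [← Module.forall_dual_apply_eq_zero_iff ℚ]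
  intro l
  have hp : (∑ j ∈ Finset.range n, Polynomial.monomial j (l (c j))) = 0 := by
    refine Polynomial.funext fun t => ?_
    have := congrArg l (h t)
    simpa [Polynomial.eval_finsetSum, mul_comm] using this
  simpa [Polynomial.finsetSum_coeff, Polynomial.coeff_monomial, hi] using
    congrArg (Polynomial.coeff · i) hp

variable {A : Type*} [Ring A] [Algebra ℚ A]

theorem coeff_eq_zero_of_add_smul_pow {v v' w : A} (hv : Commute v' v) {n : ℕ}
    (h : ∀ t : ℚ, (t • v' + v) ^ n * w = 0) {i : ℕ} (hi : i ≤ n) :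
    v' ^ i * v ^ (n - i) * w = 0 := by
  have hc := coeff_eq_zero_of_sum_pow_smul (n := n + 1)
    (c := fun i => (n.choose i : ℚ) • (v' ^ i * v ^ (n - i) * w)) (fun t => by
      rw [← h t, (hv.smul_left t).add_pow, Finset.sum_mul]
      refine Finset.sum_congr rfl fun j _ => ?_
      rw [smul_pow, smul_mul_assoc, smul_mul_assoc, smul_mul_assoc, ← nsmul_eq_mul',
        smul_mul_assoc, Nat.cast_smul_eq_nsmul]) (Nat.lt_succ_of_le hi)
  exact (smul_eq_zero.1 hc).resolve_left (by exact_mod_cast (Nat.choose_pos hi).ne')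

theorem mul_eq_zero_of_mem_pow {V : Submodule ℚ A} (hV : ∀ v ∈ V, ∀ x, Commute v x) (n : ℕ) :
    ∀ w : A, (∀ v ∈ V, v ^ n * w = 0) → ∀ x ∈ V ^ n, x * w = 0 := by
  induction n with
  | zero =>
    intro w hw x hx
    have hw0 : w = 0 := by simpa using hw 0 (zero_mem V)
    rw [hw0, mul_zero]
  | succ n ih =>
    intro w hw x hx
    rw [pow_succ] at hx
    induction hx using Submodule.mul_induction_on' with
    | add x _ y _ hx hy => rw [add_mul, hx, hy, add_zero]
    | mem_mul_mem y hy v' hv' =>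
      rw [mul_assoc]
      refine ih (v' * w) (fun v hv => ?_) y hy
      have h1 := coeff_eq_zero_of_add_smul_pow (hV v' hv' v) (n := n + 1) (w := w) (i := 1)
        (fun t => hw _ (add_mem (Submodule.smul_mem _ _ hv') hv)) (by omega)
      rwa [pow_one, Nat.add_sub_cancel, (hV v' hv' (v ^ n)).eq, mul_assoc] at h1

/-- If products of `n` elements of a central subspace do not all vanish, then the elements with
nonzero `n`-th power span that subspace. -/
theorem le_span_pow_ne_zero {V : Submodule ℚ A} (hV : ∀ v ∈ V, ∀ x, Commute v x) {n : ℕ}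
    (hn : V ^ n ≠ ⊥) : V ≤ Submodule.span ℚ {v | v ∈ V ∧ v ^ n ≠ 0} := by
  obtain ⟨v₀, hv₀, hv₀n⟩ : ∃ v ∈ V, v ^ n ≠ 0 := by
    by_contra! h
    refine hn ((Submodule.eq_bot_iff _).2 fun x hx => ?_)
    simpa using mul_eq_zero_of_mem_pow hV n 1 (by simpa using h) x hx
  intro v hv
  obtain ⟨t, ht⟩ : ∃ t : ℚ, (t • v₀ + v) ^ n ≠ 0 := by
    by_contra! h
    have := coeff_eq_zero_of_add_smul_pow (hV v₀ hv₀ v) (n := n) (w := 1) (i := n)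
      (fun t => by rw [h t, zero_mul]) le_rfl
    simp [hv₀n] at this
  have h1 : t • v₀ + v ∈ Submodule.span ℚ {v | v ∈ V ∧ v ^ n ≠ 0} :=
    Submodule.subset_span ⟨add_mem (Submodule.smul_mem _ _ hv₀) hv, ht⟩
  have h2 : t • v₀ ∈ Submodule.span ℚ {v | v ∈ V ∧ v ^ n ≠ 0} :=
    Submodule.smul_mem _ _ (Submodule.subset_span ⟨hv₀, hv₀n⟩)
  simpa using sub_mem h1 h2

end Polarization

namespace IsCohomologyAlgebra

variable {A : Type} [Ring A] [Algebra ℚ A] {𝒜 : ℕ → Submodule ℚ A} [GradedAlgebra 𝒜] {m : ℕ}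

theorem commute_of_mem_two (hA : IsCohomologyAlgebra ℚ A 𝒜 m) {a : A} (ha : a ∈ 𝒜 2) (x : A) :
    Commute a x := by
  have hx : x ∈ ⨆ k, 𝒜 k := by
    rw [(DirectSum.Decomposition.isInternal 𝒜).submodule_iSup_eq_top]; trivial
  induction hx using Submodule.iSup_induction' with
  | zero => exact Commute.zero_right a
  | add x y _ _ hx hy => exact hx.add_right hy
  | mem k x hx => simpa [Commute, SemiconjBy, pow_mul] using hA.gcomm 2 k a x ha hx

theorem nontrivial (hA : IsCohomologyAlgebra ℚ A 𝒜 m) : Nontrivial A := by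
  by_contra h
  rw [not_nontrivial_iff_subsingleton] at h
  have := hA.topRank
  rw [Module.finrank_zero_of_subsingleton] at this
  exact zero_ne_one this

/-- In an algebra generated in degrees at most two, each component is spanned by products of
elements of degree two and at most one element of degree one. -/
theorem grade_eq_pow_mul_pow (hA : IsCohomologyAlgebra ℚ A 𝒜 m)
    (hgen : Algebra.adjoin ℚ ((𝒜 1 : Set A) ∪ (𝒜 2 : Set A)) = ⊤) (k : ℕ) :
    𝒜 k = 𝒜 2 ^ (k / 2) * 𝒜 1 ^ (k % 2) := by
  let R : ℕ → Submodule ℚ A := fun k => 𝒜 2 ^ (k / 2) * 𝒜 1 ^ (k % 2)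
  have hmul : ∀ i j, 𝒜 i * 𝒜 j ≤ 𝒜 (i + j) := fun i j =>
    Submodule.mul_le.2 fun x hx y hy => SetLike.mul_mem_graded hx hy
  have hpow : ∀ i n, 𝒜 i ^ n ≤ 𝒜 (i * n) := by
    intro i n
    induction n with
    | zero => simpa using SetLike.one_mem_graded 𝒜
    | succ n ih =>
      rw [pow_succ, mul_add, mul_one]
      exact (mul_le_mul' ih le_rfl).trans (hmul _ _)
  have hle : R ≤ 𝒜 := by
    intro k
    refine (mul_le_mul' (hpow 2 _) (hpow 1 _)).trans ((hmul _ _).trans ?_)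
    rw [one_mul, Nat.div_add_mod]
  have h12 : 𝒜 1 * 𝒜 2 = 𝒜 2 * 𝒜 1 := by
    apply le_antisymm <;> rw [Submodule.mul_le] <;> intro x hx y hy
    · rw [← (hA.commute_of_mem_two hy x).eq]
      exact Submodule.mul_mem_mul hy hx
    · rw [(hA.commute_of_mem_two hx y).eq]
      exact Submodule.mul_mem_mul hy hx
  have hR2 : ∀ k, R k * 𝒜 2 ≤ R (k + 2) := by
    intro k
    have hc : Commute (𝒜 1 ^ (k % 2)) (𝒜 2) := Commute.pow_left h12 _
    simp only [R]
    rw [mul_assoc, hc.eq, ← mul_assoc, ← pow_succ, Nat.add_mod_right,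
      Nat.add_div_right k two_pos]
  have hR1 : ∀ k, R k * 𝒜 1 ≤ R (k + 1) := by
    intro k
    simp only [R]
    rcases Nat.mod_two_eq_zero_or_one k with hk | hk
    · rw [hk, show (k + 1) % 2 = 1 by omega, show (k + 1) / 2 = k / 2 by omega]
      simp
    · rw [hk, show (k + 1) % 2 = 0 by omega, show (k + 1) / 2 = k / 2 + 1 by omega,
        pow_zero, mul_one, pow_one, mul_assoc, pow_succ]
      exact mul_le_mul' le_rfl (hmul 1 1)
  have hstep : ∀ y ∈ (𝒜 1 : Set A) ∪ 𝒜 2, ∀ x ∈ iSup R, x * y ∈ iSup R := by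
    intro y hy x hx
    rcases hy with hy | hy
    · have : iSup R * 𝒜 1 ≤ iSup R := by
        rw [Submodule.iSup_mul]
        exact iSup_le fun k => (hR1 k).trans (le_iSup R _)
      exact this (Submodule.mul_mem_mul hx hy)
    · have : iSup R * 𝒜 2 ≤ iSup R := by
        rw [Submodule.iSup_mul]
        exact iSup_le fun k => (hR2 k).trans (le_iSup R _)
      exact this (Submodule.mul_mem_mul hx hy)
  have htop : iSup R = ⊤ := by
    rw [eq_top_iff, ← Algebra.top_toSubmodule, ← hgen, Algebra.adjoin_eq_span, Submodule.span_le]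
    intro x hx
    induction hx using Submonoid.closure_induction_right with
    | one => exact Submodule.mem_iSup_of_mem 0 (by simpa [R] using ⟨1, map_one _⟩)
    | mul_right x _ y hy ih => exact hstep y hy x ih
  have hind := (DirectSum.Decomposition.isInternal 𝒜).submodule_iSupIndep
  exact (congrFun ((hind.le_iff_eq_of_iSup_eq_top htop).1 hle) k).symm

theorem top_ne_bot (hA : IsCohomologyAlgebra ℚ A 𝒜 m) : 𝒜 m ≠ ⊥ := by
  intro h
  have := hA.topRank
  rw [h, finrank_bot] at this
  exact zero_ne_one this

/-- Elements of degree two whose top power is nonzero span the degree two component. -/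
theorem le_span_top_pow_ne_zero {n : ℕ} (hA : IsCohomologyAlgebra ℚ A 𝒜 (2 * n))
    (hgen : Algebra.adjoin ℚ ((𝒜 1 : Set A) ∪ (𝒜 2 : Set A)) = ⊤) :
    𝒜 2 ≤ Submodule.span ℚ {a | a ∈ 𝒜 2 ∧ a ^ n ≠ 0} := by
  refine le_span_pow_ne_zero (fun a ha => hA.commute_of_mem_two ha) ?_
  have := hA.grade_eq_pow_mul_pow hgen (2 * n)
  rw [Nat.mul_div_cancel_left n two_pos, Nat.mul_mod_right, pow_zero, mul_one] at this
  exact this ▸ hA.top_ne_bot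

theorem pow_succ_eq_zero {n : ℕ} (hA : IsCohomologyAlgebra ℚ A 𝒜 (2 * n)) {a : A}
    (ha : a ∈ 𝒜 2) : a ^ (n + 1) = 0 := by
  have h := SetLike.pow_mem_graded (n + 1) ha
  rwa [hA.vanish _ (by simp only [smul_eq_mul]; omega), Submodule.mem_bot] at h

end IsCohomologyAlgebra

section Splitting

variable {M C E : Type} [Ring M] [Algebra ℚ M] [Ring C] [Algebra ℚ C] [Ring E] [Algebra ℚ E]
  {𝕄 : ℕ → Submodule ℚ M} [GradedAlgebra 𝕄] {𝒞 : ℕ → Submodule ℚ C} [GradedAlgebra 𝒞]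
  {ℰ : ℕ → Submodule ℚ E}

/-- If degree two splits as `𝒞 2 ⊕ ℰ 2`, then a derivation preserving the degree two part of `M`
preserves the summand `𝒞 2`: differentiating `c ^ (n + 1) = 0` shows that `c ^ n` annihilates the
component of the derivative of `c` along `ℰ 2`. -/
theorem derivation_mem_range_of_mem_two {d n : ℕ} (hM : IsCohomologyAlgebra ℚ M 𝕄 d)
    (hC : IsCohomologyAlgebra ℚ C 𝒞 (2 * n))
    (hgen : Algebra.adjoin ℚ ((𝒞 1 : Set C) ∪ (𝒞 2 : Set C)) = ⊤)
    {f : C →ₗ[ℚ] M} {g : E →ₗ[ℚ] M} (hone : f 1 = 1) (hmul : ∀ x y, f (x * y) = f x * f y)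
    (hf : ∀ c ∈ 𝒞 2, f c ∈ 𝕄 2) (hsum : 𝕄 2 ≤ (𝒞 2).map f ⊔ (ℰ 2).map g)
    (hinj : ∀ c ∈ 𝒞 2, c ^ n ≠ 0 →
      Function.Injective (LinearMap.mulLeft ℚ (f (c ^ n)) ∘ₗ g))
    {D : Module.End ℂ (ℂ ⊗[ℚ] M)} (hD : ∀ x y, D (x * y) = D x * y + x * D y)
    (hD2 : ∀ x ∈ (𝕄 2).baseChange ℂ, D x ∈ (𝕄 2).baseChange ℂ) {c : C} (hc : c ∈ 𝒞 2) :
    D (1 ⊗ₜ f c) ∈ LinearMap.range (f.baseChange ℂ) := by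
  have hpow : ∀ (c : C) (k : ℕ), ((1 : ℂ) ⊗ₜ[ℚ] f c) ^ k = 1 ⊗ₜ f (c ^ k) := by
    intro c k
    induction k with
    | zero => simp [hone, Algebra.TensorProduct.one_def]
    | succ k ih => rw [pow_succ, ih, pow_succ, hmul]; simp
  have hspan := hC.le_span_top_pow_ne_zero hgen hc
  clear hc
  induction hspan using Submodule.span_induction with
  | zero => simp
  | add x y _ _ hx hy =>
    rw [map_add, TensorProduct.tmul_add, map_add]
    exact add_mem hx hy
  | smul r x _ hx =>
    rw [map_smul, TensorProduct.tmul_smul, ← algebraMap_smul ℂ, map_smul]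
    exact Submodule.smul_mem _ _ hx
  | mem c hc =>
    obtain ⟨hc, hcn⟩ := hc
    have hcomm : ∀ y, Commute ((1 : ℂ) ⊗ₜ[ℚ] f c) y := by
      intro y
      induction y with
      | zero => exact Commute.zero_right _
      | add y z hy hz => exact hy.add_right hz
      | tmul z m =>
        simp [Commute, SemiconjBy, (hM.commute_of_mem_two (hf c hc) m).eq]
    have hann : (1 : ℂ) ⊗ₜ[ℚ] f (c ^ n) * D (1 ⊗ₜ f c) = 0 := by
      have h := derivation_pow_succ hD hcomm n
      rw [hpow, hC.pow_succ_eq_zero hc, map_zero, TensorProduct.tmul_zero, map_zero, hpow] at h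
      have hunit : ((n : ℂ) + 1) • ((1 : ℂ) ⊗ₜ[ℚ] f (c ^ n) * D (1 ⊗ₜ f c)) = 0 := by
        rw [Algebra.smul_def, map_add, map_natCast, map_one, ← h]
      exact (smul_eq_zero.1 hunit).resolve_left (Nat.cast_add_one_ne_zero n)
    have hmem := Submodule.baseChange_sup_le _ _ (Submodule.baseChange_mono (A := ℂ) hsum
      (hD2 _ (Submodule.tmul_mem_baseChange_of_mem 1 (hf c hc))))
    rw [Submodule.map_baseChange, Submodule.map_baseChange] at hmem
    obtain ⟨_, ⟨u, hu, rfl⟩, _, ⟨v, hv, rfl⟩, huv⟩ := Submodule.mem_sup.1 hmem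
    have hu0 : (1 : ℂ) ⊗ₜ[ℚ] (c ^ n) * u = 0 := by
      have hle : (𝒞 2).baseChange ℂ ≤
          LinearMap.ker (LinearMap.mulLeft ℂ ((1 : ℂ) ⊗ₜ[ℚ] (c ^ n))) := by
        refine Submodule.baseChange_le fun w hw => ?_
        have hw0 := SetLike.mul_mem_graded (SetLike.pow_mem_graded n hc) hw
        rw [hC.vanish _ (by simp only [smul_eq_mul]; omega), Submodule.mem_bot] at hw0
        simp [hw0]
      exact hle hu
    have hfu : (1 : ℂ) ⊗ₜ[ℚ] f (c ^ n) * f.baseChange ℂ u = 0 := by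
      rw [← LinearMap.baseChange_tmul, ← baseChange_map_mul hmul, hu0, map_zero]
    have hgv : (LinearMap.mulLeft ℚ (f (c ^ n)) ∘ₗ g).baseChange ℂ v =
        (1 : ℂ) ⊗ₜ[ℚ] f (c ^ n) * g.baseChange ℂ v := by
      clear huv hv
      induction v with
      | zero => simp
      | add v w hv hw => simp only [map_add, mul_add, hv, hw]
      | tmul z e => simp
    have hv0 : v = 0 := by
      apply baseChange_injective (hinj c hc hcn)
      rw [hgv, map_zero, ← hann, ← huv, mul_add, hfu, zero_add]
    rw [← huv, hv0, map_zero, add_zero]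
    exact LinearMap.mem_range_self _ u

end Splitting

theorem map_mul_of_homogeneous {M C : Type} [Ring M] [Algebra ℚ M] [Ring C] [Algebra ℚ C]
    (𝒞 : ℕ → Submodule ℚ C) [GradedAlgebra 𝒞] {f : C →ₗ[ℚ] M}
    (h : ∀ i j, ∀ x ∈ 𝒞 i, ∀ y ∈ 𝒞 j, f (x * y) = f x * f y) (x y : C) :
    f (x * y) = f x * f y := by
  have htop := (DirectSum.Decomposition.isInternal 𝒞).submodule_iSup_eq_top
  have hx : x ∈ ⨆ k, 𝒞 k := htop ▸ Submodule.mem_top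
  have hy : y ∈ ⨆ k, 𝒞 k := htop ▸ Submodule.mem_top
  induction hx using Submodule.iSup_induction' with
  | zero => simp
  | add x x' _ _ h h' => simp only [add_mul, map_add, h, h']
  | mem i x hx =>
    induction hy using Submodule.iSup_induction' with
    | zero => simp
    | add y y' _ _ h h' => simp only [mul_add, map_add, h, h']
    | mem j y hy => exact h i j x hx y hy

theorem tmul_left_injective {V W : Type} [AddCommGroup V] [Module ℚ V] [AddCommGroup W]
    [Module ℚ W] {w : W} (hw : w ≠ 0) : Function.Injective fun v : V => v ⊗ₜ[ℚ] w := by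
  have h := Module.Flat.lTensor_preserves_injective_linearMap (M := V)
    (LinearMap.toSpanSingleton ℚ W w) (smul_left_injective ℚ hw)
  intro x y hxy
  have h' := @h (x ⊗ₜ 1) (y ⊗ₜ 1) (by simpa using hxy)
  simpa using congrArg (TensorProduct.rid ℚ V) h'

theorem tmul_right_injective {V W : Type} [AddCommGroup V] [Module ℚ V] [AddCommGroup W]
    [Module ℚ W] {v : V} (hv : v ≠ 0) : Function.Injective fun w : W => v ⊗ₜ[ℚ] w := by
  intro x y hxy
  exact tmul_left_injective hv (by simpa using congrArg (TensorProduct.comm ℚ V W) hxy)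

namespace IsGradedTensorIso

variable {A B M : Type} [Ring A] [Algebra ℚ A] [Ring B] [Algebra ℚ B] [Ring M] [Algebra ℚ M]
  {𝒜 : ℕ → Submodule ℚ A} {ℬ : ℕ → Submodule ℚ B} {𝕄 : ℕ → Submodule ℚ M}
  {φ : (A ⊗[ℚ] B) ≃ₗ[ℚ] M}

theorem inclA_mem [GradedAlgebra ℬ] (hφ : IsGradedTensorIso A B M 𝒜 ℬ 𝕄 φ) (k : ℕ) (x : A) (hx : x ∈ 𝒜 k) :
    inclA A B M φ x ∈ 𝕄 k :=
  hφ.map_grade k 0 x hx 1 SetLike.GradedOne.one_mem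

theorem inclB_mem [GradedAlgebra 𝒜] (hφ : IsGradedTensorIso A B M 𝒜 ℬ 𝕄 φ) (k : ℕ) (x : B) (hx : x ∈ ℬ k) :
    inclB A B M φ x ∈ 𝕄 k := by
  simpa [inclB] using hφ.map_grade 0 k 1 SetLike.GradedOne.one_mem x hx

theorem map_tmul_le_inclA [GradedAlgebra ℬ] {t : ℕ} (hB : IsCohomologyAlgebra ℚ B ℬ t) (i : ℕ) :
    Submodule.map φ.toLinearMap (Submodule.map₂ (TensorProduct.mk ℚ A B) (𝒜 i) (ℬ 0)) ≤
      (𝒜 i).map (inclA A B M φ) := by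
  rw [Submodule.map_le_iff_le_comap, Submodule.map₂_le]
  intro a ha b hb
  obtain ⟨c, rfl⟩ := Submodule.mem_span_singleton.1 (hB.degZero hb)
  exact ⟨c • a, Submodule.smul_mem _ _ ha, by simp [inclA]⟩

theorem map_tmul_le_inclB [GradedAlgebra 𝒜] {s : ℕ} (hA : IsCohomologyAlgebra ℚ A 𝒜 s) (j : ℕ) :
    Submodule.map φ.toLinearMap (Submodule.map₂ (TensorProduct.mk ℚ A B) (𝒜 0) (ℬ j)) ≤
      (ℬ j).map (inclB A B M φ) := by
  rw [Submodule.map_le_iff_le_comap, Submodule.map₂_le]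
  intro a ha b hb
  obtain ⟨c, rfl⟩ := Submodule.mem_span_singleton.1 (hA.degZero ha)
  exact ⟨c • b, Submodule.smul_mem _ _ hb, by simp [inclB]⟩

theorem grade_one_le [GradedAlgebra 𝒜] {s : ℕ} (hφ : IsGradedTensorIso A B M 𝒜 ℬ 𝕄 φ)
    (hA : IsCohomologyAlgebra ℚ A 𝒜 s) (hdeg1 : 𝒜 1 = ⊥) :
    𝕄 1 ≤ (ℬ 1).map (inclB A B M φ) := by
  rw [hφ.grade_eq 1]
  refine iSup_le fun i => iSup_le fun j => iSup_le fun hij => ?_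
  obtain ⟨rfl, rfl⟩ | ⟨rfl, rfl⟩ : (i = 0 ∧ j = 1) ∨ (i = 1 ∧ j = 0) := by omega
  · exact map_tmul_le_inclB hA 1
  · simp [hdeg1]

variable [GradedAlgebra 𝒜] [GradedAlgebra ℬ]

theorem inclA_mul (hφ : IsGradedTensorIso A B M 𝒜 ℬ 𝕄 φ) (x y : A) :
    inclA A B M φ (x * y) = inclA A B M φ x * inclA A B M φ y := by
  refine map_mul_of_homogeneous 𝒜 (fun i j x hx y hy => ?_) x y
  have := hφ.map_mul i 0 j 0 x hx 1 SetLike.GradedOne.one_mem y hy 1 SetLike.GradedOne.one_mem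
  simpa [inclA] using this.symm

theorem inclB_mul (hφ : IsGradedTensorIso A B M 𝒜 ℬ 𝕄 φ) (x y : B) :
    inclB A B M φ (x * y) = inclB A B M φ x * inclB A B M φ y := by
  refine map_mul_of_homogeneous ℬ (fun i j x hx y hy => ?_) x y
  have := hφ.map_mul 0 i 0 j 1 SetLike.GradedOne.one_mem x hx 1 SetLike.GradedOne.one_mem y hy
  simpa [inclB] using this.symm

theorem inclA_mul_inclB (hφ : IsGradedTensorIso A B M 𝒜 ℬ 𝕄 φ) (x : A) (y : B) :
    inclA A B M φ x * inclB A B M φ y = φ (x ⊗ₜ y) := by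
  have hx : x ∈ ⨆ k, 𝒜 k :=
    (DirectSum.Decomposition.isInternal 𝒜).submodule_iSup_eq_top ▸ Submodule.mem_top
  have hy : y ∈ ⨆ k, ℬ k :=
    (DirectSum.Decomposition.isInternal ℬ).submodule_iSup_eq_top ▸ Submodule.mem_top
  induction hx using Submodule.iSup_induction' with
  | zero => simp
  | add x x' _ _ h h' => simp only [add_mul, map_add, TensorProduct.add_tmul, h, h']
  | mem i x hx =>
    induction hy using Submodule.iSup_induction' with
    | zero => simp
    | add y y' _ _ h h' => simp only [mul_add, map_add, TensorProduct.tmul_add, h, h']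
    | mem j y hy =>
      have := hφ.map_mul i 0 0 j x hx 1 SetLike.GradedOne.one_mem 1 SetLike.GradedOne.one_mem y hy
      simpa [inclA, inclB] using this

theorem grade_two_le {s t : ℕ} (hφ : IsGradedTensorIso A B M 𝒜 ℬ 𝕄 φ)
    (hA : IsCohomologyAlgebra ℚ A 𝒜 s) (hB : IsCohomologyAlgebra ℚ B ℬ t) (hdeg1 : 𝒜 1 = ⊥) :
    𝕄 2 ≤ (𝒜 2).map (inclA A B M φ) ⊔ (ℬ 2).map (inclB A B M φ) := by
  rw [hφ.grade_eq 2]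
  refine iSup_le fun i => iSup_le fun j => iSup_le fun hij => ?_
  obtain ⟨rfl, rfl⟩ | ⟨rfl, rfl⟩ | ⟨rfl, rfl⟩ :
    (i = 0 ∧ j = 2) ∨ (i = 1 ∧ j = 1) ∨ (i = 2 ∧ j = 0) := by omega
  · exact (map_tmul_le_inclB hA 2).trans le_sup_right
  · simp [hdeg1]
  · exact (map_tmul_le_inclA hB 2).trans le_sup_left

theorem range_inclA_mul_range_inclB (hφ : IsGradedTensorIso A B M 𝒜 ℬ 𝕄 φ) :
    LinearMap.range ((inclA A B M φ).baseChange ℂ) *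
      LinearMap.range ((inclB A B M φ).baseChange ℂ) = ⊤ := by
  rw [eq_top_iff, ← Submodule.baseChange_top]
  refine Submodule.baseChange_le fun m hm => ?_
  clear hm
  obtain ⟨z, rfl⟩ := φ.surjective m
  induction z with
  | zero => simp
  | add x y hx hy => rw [map_add, TensorProduct.tmul_add]; exact add_mem hx hy
  | tmul a b =>
    have hab : (1 : ℂ) ⊗ₜ[ℚ] φ (a ⊗ₜ b) =
        (inclA A B M φ).baseChange ℂ (1 ⊗ₜ a) * (inclB A B M φ).baseChange ℂ (1 ⊗ₜ b) := by
      simp [hφ.inclA_mul_inclB]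
    rw [hab]
    exact Submodule.mul_mem_mul (LinearMap.mem_range_self _ _) (LinearMap.mem_range_self _ _)

/-- A Hodge structure on `M` is the tensor product of the structures it restricts to on `A` and
`B`. -/
theorem H_eq_iSup_mul [GradedAlgebra 𝕄] (hφ : IsGradedTensorIso A B M 𝒜 ℬ 𝕄 φ)
    (HS : AlgHodgeStructureQ M 𝕄) {KA : ℕ → ℤ → Submodule ℂ (ℂ ⊗[ℚ] A)}
    {KB : ℕ → ℤ → Submodule ℂ (ℂ ⊗[ℚ] B)}
    (hKA : ∀ k p, KA k p = (HS.H k p).comap ((inclA A B M φ).baseChange ℂ))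
    (hKB : ∀ k p, KB k p = (HS.H k p).comap ((inclB A B M φ).baseChange ℂ))
    (hA : ⨆ i : ℕ × ℤ, KA i.1 i.2 = ⊤) (hB : ⨆ i : ℕ × ℤ, KB i.1 i.2 = ⊤) (k : ℕ) (p : ℤ) :
    HS.H k p =
      ⨆ (i : ℕ) (j : ℕ) (_ : i + j = k) (p₁ : ℤ) (p₂ : ℤ) (_ : p₁ + p₂ = p),
        Submodule.map (LinearMap.baseChange ℂ (inclA A B M φ)) (KA i p₁) *
          Submodule.map (LinearMap.baseChange ℂ (inclB A B M φ)) (KB j p₂) := by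
  let R : ℕ × ℤ → Submodule ℂ (ℂ ⊗[ℚ] M) := fun x =>
    ⨆ (i : ℕ) (j : ℕ) (_ : i + j = x.1) (p₁ : ℤ) (p₂ : ℤ) (_ : p₁ + p₂ = x.2),
      Submodule.map (LinearMap.baseChange ℂ (inclA A B M φ)) (KA i p₁) *
        Submodule.map (LinearMap.baseChange ℂ (inclB A B M φ)) (KB j p₂)
  have hle : R ≤ fun x : ℕ × ℤ => HS.H x.1 x.2 := by
    rintro ⟨k, p⟩
    refine iSup_le fun i => iSup_le fun j => iSup_le ?_
    rintro (rfl : i + j = k)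
    refine iSup_le fun p₁ => iSup_le fun p₂ => iSup_le ?_
    rintro (rfl : p₁ + p₂ = p)
    rw [Submodule.mul_le]
    rintro _ ⟨x, hx, rfl⟩ _ ⟨y, hy, rfl⟩
    rw [hKA] at hx
    rw [hKB] at hy
    exact HS.mul_mem i j p₁ p₂ _ hx _ hy
  have htop : iSup R = ⊤ := by
    rw [eq_top_iff, ← hφ.range_inclA_mul_range_inclB, LinearMap.range_eq_map, ← hA,
      LinearMap.range_eq_map, ← hB, Submodule.map_iSup, Submodule.map_iSup, Submodule.iSup_mul]
    refine iSup_le fun x => ?_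
    rw [Submodule.mul_iSup]
    refine iSup_le fun y => le_iSup_of_le (x + y) ?_
    exact le_iSup_of_le x.1 <| le_iSup_of_le y.1 <| le_iSup_of_le rfl <|
      le_iSup_of_le x.2 <| le_iSup_of_le y.2 <| le_iSup_of_le rfl le_rfl
  exact (congrFun ((HS.iSupIndep_H.le_iff_eq_of_iSup_eq_top htop).1 hle) (k, p)).symm

end IsGradedTensorIso

theorem stmt13 (A B M : Type) [Ring A] [Algebra ℚ A] [Ring B] [Algebra ℚ B]
    [Ring M] [Algebra ℚ M]
    (𝒜 : ℕ → Submodule ℚ A) (ℬ : ℕ → Submodule ℚ B) (𝕄 : ℕ → Submodule ℚ M)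
    [GradedAlgebra 𝒜] [GradedAlgebra ℬ] [GradedAlgebra 𝕄]
    (s t : ℕ) (hA : IsCohomologyAlgebra ℚ A 𝒜 s) (hB : IsCohomologyAlgebra ℚ B ℬ t)
    (hdeg1 : 𝒜 1 = ⊥)
    (hAgen : Algebra.adjoin ℚ ((𝒜 1 : Set A) ∪ (𝒜 2 : Set A)) = ⊤)
    (hBgen : Algebra.adjoin ℚ ((ℬ 1 : Set B) ∪ (ℬ 2 : Set B)) = ⊤)
    (hM : IsCohomologyAlgebra ℚ M 𝕄 (s + t))
    (φ : (A ⊗[ℚ] B) ≃ₗ[ℚ] M) (hφ : IsGradedTensorIso A B M 𝒜 ℬ 𝕄 φ)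
    (HS : AlgHodgeStructureQ M 𝕄) :
    Even s ∧ Even t ∧
    ∃ (HSA : AlgHodgeStructureQ A 𝒜) (HSB : AlgHodgeStructureQ B ℬ),
      ∀ (k : ℕ) (p : ℤ),
        HS.H k p =
          ⨆ (i : ℕ) (j : ℕ) (_ : i + j = k) (p₁ : ℤ) (p₂ : ℤ) (_ : p₁ + p₂ = p),
            Submodule.map (LinearMap.baseChange ℂ (inclA A B M φ)) (HSA.H i p₁) *
              Submodule.map (LinearMap.baseChange ℂ (inclB A B M φ)) (HSB.H j p₂) := by
  have hs : Even s := by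
    by_contra hodd
    have h := hA.grade_eq_pow_mul_pow hAgen s
    rw [Nat.not_even_iff.1 hodd, hdeg1, pow_one, Submodule.mul_bot] at h
    exact hA.top_ne_bot h
  have ht : Even t := (Nat.even_add.1 (HS.even_of_finrank_eq_one hM.topRank)).1 hs
  refine ⟨hs, ht, ?_⟩
  obtain ⟨n, rfl⟩ := even_iff_exists_two_mul.1 hs
  obtain ⟨m, rfl⟩ := even_iff_exists_two_mul.1 ht
  have := hA.nontrivial
  have := hB.nontrivial
  have := hM.finite
  obtain ⟨D, hDH, hD⟩ := HS.exists_derivation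
  have hDgrade : ∀ k, ∀ x ∈ (𝕄 k).baseChange ℂ, D x ∈ (𝕄 k).baseChange ℂ :=
    fun k x hx => AlgHodgeStructureQ.derivation_mem_grade hDH hx
  have hinjA : Function.Injective (inclA A B M φ) :=
    φ.injective.comp (tmul_left_injective one_ne_zero)
  have hinjB : Function.Injective (inclB A B M φ) :=
    φ.injective.comp (tmul_right_injective one_ne_zero)
  have honeB : inclB A B M φ 1 = 1 := hφ.map_one
  have hsum := hφ.grade_two_le hA hB hdeg1
  have hstabA := derivation_mem_range (f := inclA A B M φ) hφ.map_one hφ.inclA_mul hD hAgen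
    fun a ha => by
      rcases ha with ha | ha
      · rw [hdeg1] at ha
        have ha0 : a = 0 := ha
        simp [ha0]
      · refine derivation_mem_range_of_mem_two hM hA hAgen hφ.map_one hφ.inclA_mul
          (hφ.inclA_mem 2) hsum (fun c _ hcn => ?_) hD (hDgrade 2) ha
        have h : ⇑(LinearMap.mulLeft ℚ (inclA A B M φ (c ^ n)) ∘ₗ inclB A B M φ) =
            φ ∘ fun b => (c ^ n) ⊗ₜ[ℚ] b := funext fun b => hφ.inclA_mul_inclB _ _
        rw [h]
        exact φ.injective.comp (tmul_right_injective hcn)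
  have hstabB := derivation_mem_range (f := inclB A B M φ) honeB hφ.inclB_mul hD hBgen
    fun b hb => by
      rcases hb with hb | hb
      · have h1 := hDgrade 1 _ (Submodule.tmul_mem_baseChange_of_mem 1 (hφ.inclB_mem 1 b hb))
        have h2 := Submodule.baseChange_mono (A := ℂ) (hφ.grade_one_le hA hdeg1) h1
        rw [Submodule.map_baseChange] at h2
        exact LinearMap.map_le_range h2
      · refine derivation_mem_range_of_mem_two hM hB hBgen honeB hφ.inclB_mul
          (hφ.inclB_mem 2) (sup_comm _ ((𝒜 2).map (inclA A B M φ)) ▸ hsum)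
          (fun c hc hcn => ?_) hD (hDgrade 2) hb
        have hpow : ∀ k, inclB A B M φ (c ^ k) = inclB A B M φ c ^ k := by
          intro k
          induction k with
          | zero => simpa using honeB
          | succ k ih => rw [pow_succ, hφ.inclB_mul, ih, pow_succ]
        have h : ⇑(LinearMap.mulLeft ℚ (inclB A B M φ (c ^ m)) ∘ₗ inclA A B M φ) =
            φ ∘ fun a => a ⊗ₜ[ℚ] (c ^ m) := by
          funext a
          have hcomm := (hM.commute_of_mem_two (hφ.inclB_mem 2 c hc) (inclA A B M φ a)).pow_left m
          rw [← hpow] at hcomm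
          exact hcomm.eq.trans (hφ.inclA_mul_inclB _ _)
        rw [h]
        exact φ.injective.comp (tmul_left_injective hcn)
  have hrangeA := AlgHodgeStructureQ.le_iSup_inf_H hDH hstabA
  have hrangeB := AlgHodgeStructureQ.le_iSup_inf_H hDH hstabB
  exact ⟨HS.comap _ hinjA hφ.inclA_mul hφ.inclA_mem hrangeA,
    HS.comap _ hinjB hφ.inclB_mul hφ.inclB_mem hrangeB,
    hφ.H_eq_iSup_mul HS (fun _ _ => rfl) (fun _ _ => rfl)
      (HS.iSup_comap_H hinjA hrangeA) (HS.iSup_comap_H hinjB hrangeB)⟩
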